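/- No two chordal hyperplanes meet in complex hyperbolic 10-space: if r and s are chordal roots of Λ such that neither is a ℂ-scalar multiple of the other in ℂ¹¹, then there is no vector x ∈ ℂ¹¹ with ⟨x,x⟩ < 0 and ⟨x,r⟩ = ⟨x,s⟩ = 0. -/

import Mathlib

noncomputable section

/-- The primitive cube root of unity `ω = e^{2πi/3}`. -/
def ω : ℂ := ⟨-1/2, Real.sqrt 3 / 2⟩

/-- `θ = ω - ω̄`, a square root of `-3`. -/
def θ : ℂ := ω - (starRingEnd ℂ) ω

/-- The ring of Eisenstein integers `ℰ = ℤ[ω]` as a subring of ℂ. -/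
def Eis : Subring ℂ := Subring.closure {ω}

/-- The Gram matrix of `E₈^ℰ`. -/
def Bmat : Matrix (Fin 4) (Fin 4) ℂ :=
  !![3, θ, 0, 0; -θ, 3, θ, 0; 0, -θ, 3, θ; 0, 0, -θ, 3]

/-- The Gram matrix of the hyperbolic cell `H`. -/
def Cmat : Matrix (Fin 2) (Fin 2) ℂ := !![0, θ; -θ, 0]

/-- The Gram matrix of `Λ₁₀`: block diagonal with blocks B, B, C. -/
def Lam10 : Matrix (Fin 10) (Fin 10) ℂ := Matrix.of fun i j =>
  if h : i.val < 4 ∧ j.val < 4 then Bmat ⟨i.val, h.1⟩ ⟨j.val, h.2⟩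
  else if h : 4 ≤ i.val ∧ i.val < 8 ∧ 4 ≤ j.val ∧ j.val < 8 then
    Bmat ⟨i.val - 4, by omega⟩ ⟨j.val - 4, by omega⟩
  else if h : 8 ≤ i.val ∧ 8 ≤ j.val then
    Cmat ⟨i.val - 8, by have := i.isLt; omega⟩ ⟨j.val - 8, by have := j.isLt; omega⟩
  else 0

/-- The Gram matrix of `Λ = (3) ⊕ Λ₁₀`: block diagonal with blocks (3), B, B, C. -/
def Lam11 : Matrix (Fin 11) (Fin 11) ℂ := Matrix.of fun i j =>
  if i.val = 0 ∧ j.val = 0 then 3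
  else if h : 1 ≤ i.val ∧ 1 ≤ j.val then
    Lam10 ⟨i.val - 1, by have := i.isLt; omega⟩ ⟨j.val - 1, by have := j.isLt; omega⟩
  else 0

/-- The Hermitian form of `Λ`, on vectors with complex entries. -/
def herm11C (x y : Fin 11 → ℂ) : ℂ :=
  ∑ i : Fin 11, ∑ j : Fin 11, Lam11 i j * x i * (starRingEnd ℂ) (y j)

/-- The ideal `θℰ ⊆ ℂ`. -/
def thetaEis : Set ℂ := {z | ∃ e : Eis, z = θ * (e : ℂ)}

/-- The ideal `3ℰ ⊆ ℂ`. -/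
def threeEis : Set ℂ := {z | ∃ e : Eis, z = 3 * (e : ℂ)}

/-- The set `{⟨r,x⟩ : x ∈ Λ}` of inner products of `r` with lattice vectors. -/
def innerSet (r : Fin 11 → ℂ) : Set ℂ :=
  {c | ∃ x : Fin 11 → ℂ, (∀ i, x i ∈ Eis) ∧ c = herm11C r x}


open ComplexConjugate

lemma sqrt_three_mul_self : Real.sqrt 3 * Real.sqrt 3 = 3 := Real.mul_self_sqrt (by norm_num)

lemma omega_sq : ω * ω = -1 - ω := by
  have := sqrt_three_mul_self
  apply Complex.ext <;> simp [ω] <;> linarith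

lemma conj_omega : conj ω = -1 - ω := by
  apply Complex.ext <;> simp [ω]; norm_num

lemma theta_eq : θ = 1 + 2 * ω := by
  rw [θ, conj_omega]; ring

lemma theta_mul_self : θ * θ = -3 := by
  rw [theta_eq]; linear_combination 4 * omega_sq

lemma conj_theta : conj θ = -θ := by
  simp [θ]

lemma theta_ne_zero : θ ≠ 0 := by
  intro h
  have := theta_mul_self
  norm_num [h] at this

lemma mem_Eis_iff {z : ℂ} : z ∈ Eis ↔ ∃ a b : ℤ, z = a + b * ω := by
  constructor
  · intro hz
    induction hz using Subring.closure_induction with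
    | mem x hx => exact ⟨0, 1, by simp_all⟩
    | zero => exact ⟨0, 0, by simp⟩
    | one => exact ⟨1, 0, by simp⟩
    | add x y _ _ hx hy =>
      obtain ⟨a, b, rfl⟩ := hx
      obtain ⟨c, d, rfl⟩ := hy
      exact ⟨a + c, b + d, by push_cast; ring⟩
    | neg x _ hx =>
      obtain ⟨a, b, rfl⟩ := hx
      exact ⟨-a, -b, by push_cast; ring⟩
    | mul x y _ _ hx hy =>
      obtain ⟨a, b, rfl⟩ := hx
      obtain ⟨c, d, rfl⟩ := hy
      exact ⟨a * c - b * d, a * d + b * c - b * d, by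
        push_cast; linear_combination (b * d : ℂ) * omega_sq⟩
  · rintro ⟨a, b, rfl⟩
    exact add_mem (intCast_mem _ a) (mul_mem (intCast_mem _ b) (Subring.subset_closure rfl))

lemma conj_mem_Eis {z : ℂ} (hz : z ∈ Eis) : conj z ∈ Eis := by
  obtain ⟨a, b, rfl⟩ := mem_Eis_iff.1 hz
  exact mem_Eis_iff.2 ⟨a - b, -b, by simp [conj_omega]; ring⟩

lemma exists_normSq_eq (z : Eis) : ∃ n : ℤ, Complex.normSq z = n := by
  obtain ⟨a, b, h⟩ := mem_Eis_iff.1 z.2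
  refine ⟨a * a - a * b + b * b, ?_⟩
  have := sqrt_three_mul_self
  rw [h, Complex.normSq_apply]
  simp [ω]
  linear_combination (b * b / 4 : ℝ) * this

lemma one_le_normSq (z : Eis) (hz : (z : ℂ) ≠ 0) : 1 ≤ Complex.normSq z := by
  obtain ⟨n, hn⟩ := exists_normSq_eq z
  have := Complex.normSq_pos.2 hz
  rw [hn] at this ⊢
  exact_mod_cast this

/-- `θ` as an Eisenstein integer. -/
def θE : Eis := ⟨θ, mem_Eis_iff.2 ⟨1, 2, by rw [theta_eq]; push_cast; rfl⟩⟩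

lemma coe_θE : (θE : ℂ) = θ := rfl

lemma theta_mul_ne_one (z : Eis) : θ * z ≠ 1 := by
  intro h
  obtain ⟨n, hn⟩ := exists_normSq_eq z
  have h3 : Complex.normSq θ = 3 := by
    apply Complex.ofReal_injective
    rw [← Complex.mul_conj, conj_theta]
    push_cast
    linear_combination -theta_mul_self
  have := congrArg Complex.normSq h
  rw [map_mul, hn, h3, map_one] at this
  have : 3 * n = 1 := by exact_mod_cast this
  omega

lemma herm11C_apply (x y : Fin 11 → ℂ) : herm11C x y =
    3 * x 0 * conj (y 0)
    + (3 * x 1 - θ * x 2) * conj (y 1) + (θ * x 1 + 3 * x 2 - θ * x 3) * conj (y 2)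
    + (θ * x 2 + 3 * x 3 - θ * x 4) * conj (y 3) + (θ * x 3 + 3 * x 4) * conj (y 4)
    + (3 * x 5 - θ * x 6) * conj (y 5) + (θ * x 5 + 3 * x 6 - θ * x 7) * conj (y 6)
    + (θ * x 6 + 3 * x 7 - θ * x 8) * conj (y 7) + (θ * x 7 + 3 * x 8) * conj (y 8)
    - θ * x 10 * conj (y 9) + θ * x 9 * conj (y 10) := by
  simp [herm11C, Fin.sum_univ_succ, Lam11, Lam10, Bmat, Cmat]
  ring

lemma herm11C_sub_smul_left (x y w : Fin 11 → ℂ) (c : ℂ) :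
    herm11C (x - c • y) w = herm11C x w - c * herm11C y w := by
  simp only [herm11C_apply, Pi.sub_apply, Pi.smul_apply, smul_eq_mul]
  ring

lemma herm11C_sub_smul_right (x y w : Fin 11 → ℂ) (c : ℂ) :
    herm11C w (x - c • y) = herm11C w x - conj c * herm11C w y := by
  simp only [herm11C_apply, Pi.sub_apply, Pi.smul_apply, smul_eq_mul, map_sub, map_mul]
  ring

lemma herm11C_conj (x y : Fin 11 → ℂ) : herm11C x y = conj (herm11C y x) := by
  simp only [herm11C_apply, map_add, map_sub, map_mul, conj_theta, Complex.conj_conj,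
    Complex.conj_ofNat]
  ring

/-- The form is positive definite on the hyperplane `x₁₀ = θ x₉`. -/
lemma eq_zero_of_herm11C_nonpos {w : Fin 11 → ℂ} (hl : w 10 = θ * w 9)
    (hw : (herm11C w w).re ≤ 0) : w = 0 := by
  have key : herm11C w w = ((3 * Complex.normSq (w 0)
      + (3 * Complex.normSq (w 1 - θ / 3 * w 2) + 2 * Complex.normSq (w 2 - θ / 2 * w 3)
        + 3 / 2 * Complex.normSq (w 3 - 2 * θ / 3 * w 4) + Complex.normSq (w 4))
      + (3 * Complex.normSq (w 5 - θ / 3 * w 6) + 2 * Complex.normSq (w 6 - θ / 2 * w 7)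
        + 3 / 2 * Complex.normSq (w 7 - 2 * θ / 3 * w 8) + Complex.normSq (w 8))
      + 6 * Complex.normSq (w 9) : ℝ) : ℂ) := by
    push_cast
    simp only [← Complex.mul_conj, herm11C_apply, map_sub, map_mul, map_div₀, conj_theta,
      Complex.conj_ofNat, hl]
    linear_combination (-2 * w 9 * conj (w 9) + w 2 * conj (w 2) / 3
      + w 3 * conj (w 3) / 2 + 2 * w 4 * conj (w 4) / 3 + w 6 * conj (w 6) / 3
      + w 7 * conj (w 7) / 2 + 2 * w 8 * conj (w 8) / 3) * theta_mul_self
  rw [key, Complex.ofReal_re] at hw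
  have nn := Complex.normSq_nonneg
  have h0 := nn (w 0)
  have h1 := nn (w 1 - θ / 3 * w 2)
  have h2 := nn (w 2 - θ / 2 * w 3)
  have h3 := nn (w 3 - 2 * θ / 3 * w 4)
  have h4 := nn (w 4)
  have h5 := nn (w 5 - θ / 3 * w 6)
  have h6 := nn (w 6 - θ / 2 * w 7)
  have h7 := nn (w 7 - 2 * θ / 3 * w 8)
  have h8 := nn (w 8)
  have h9 := nn (w 9)
  have z {a : ℂ} (h : Complex.normSq a ≤ 0) : a = 0 :=
    Complex.normSq_eq_zero.1 (le_antisymm h (nn a))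
  have e0 : w 0 = 0 := z (by linarith)
  have e4 : w 4 = 0 := z (by linarith)
  have e3 : w 3 = 0 := by simpa [e4] using z (a := w 3 - 2 * θ / 3 * w 4) (by linarith)
  have e2 : w 2 = 0 := by simpa [e3] using z (a := w 2 - θ / 2 * w 3) (by linarith)
  have e1 : w 1 = 0 := by simpa [e2] using z (a := w 1 - θ / 3 * w 2) (by linarith)
  have e8 : w 8 = 0 := z (by linarith)
  have e7 : w 7 = 0 := by simpa [e8] using z (a := w 7 - 2 * θ / 3 * w 8) (by linarith)
  have e6 : w 6 = 0 := by simpa [e7] using z (a := w 6 - θ / 2 * w 7) (by linarith)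
  have e5 : w 5 = 0 := by simpa [e6] using z (a := w 5 - θ / 3 * w 6) (by linarith)
  have e9 : w 9 = 0 := z (by linarith)
  have e10 : w 10 = 0 := by rw [hl, e9, mul_zero]
  funext i
  fin_cases i <;> assumption

/-- The orthogonal complement of a negative vector is positive definite. -/
lemma eq_zero_of_orthogonal_of_neg {x v : Fin 11 → ℂ} (hx : (herm11C x x).re < 0)
    (hxv : herm11C x v = 0) (hv : (herm11C v v).re ≤ 0) : v = 0 := by
  have hl : x 10 - θ * x 9 ≠ 0 := by
    intro h
    have := eq_zero_of_herm11C_nonpos (sub_eq_zero.1 h) hx.le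
    simp [this, herm11C] at hx
  obtain ⟨c, hc⟩ : ∃ c, v 10 - θ * v 9 = c * (x 10 - θ * x 9) :=
    ⟨_, (div_mul_cancel₀ _ hl).symm⟩
  have hvx : herm11C v x = 0 := by rw [herm11C_conj, hxv, map_zero]
  have hw : herm11C (v - c • x) (v - c • x)
      = herm11C v v + (Complex.normSq c : ℂ) * herm11C x x := by
    rw [herm11C_sub_smul_right, herm11C_sub_smul_left, herm11C_sub_smul_left, hxv, hvx,
      ← Complex.mul_conj]
    ring
  have hnn := Complex.normSq_nonneg c
  have hvc : v - c • x = 0 := by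
    apply eq_zero_of_herm11C_nonpos
    · simp only [Pi.sub_apply, Pi.smul_apply, smul_eq_mul]
      linear_combination hc
    · rw [hw, Complex.add_re, Complex.re_ofReal_mul]
      nlinarith
  have hc0 : c = 0 := by
    have h := herm11C_sub_smul_left v x x c
    rw [hvc, hvx] at h
    have hxx : herm11C x x ≠ 0 := fun h => by simp [h] at hx
    have h0 : herm11C 0 x = 0 := by simp [herm11C]
    rw [h0] at h
    simpa [hxx] using h
  simpa [hc0] using hvc

/-- A row vector of the Gram matrix `B` divisible by `3` comes from a vector divisible by `θ`. -/
lemma exists_eq_theta_mul_of_Bmat {p q r s : Eis} {a b c d : Eis}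
    (ha : 3 * (p : ℂ) - θ * q = 3 * a) (hb : θ * p + 3 * (q : ℂ) - θ * r = 3 * b)
    (hc : θ * q + 3 * (r : ℂ) - θ * s = 3 * c) (hd : θ * r + 3 * (s : ℂ) = 3 * d) :
    (∃ t : Eis, (p : ℂ) = θ * t) ∧ (∃ t : Eis, (q : ℂ) = θ * t) ∧
      (∃ t : Eis, (r : ℂ) = θ * t) ∧ ∃ t : Eis, (s : ℂ) = θ * t := by
  have h := theta_mul_self
  have hq : (q : ℂ) = θ * (a - p : Eis) := by
    apply mul_left_cancel₀ theta_ne_zero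
    push_cast
    linear_combination -ha - (a - p : ℂ) * h
  have hr : (r : ℂ) = θ * (s - d : Eis) := by
    apply mul_left_cancel₀ theta_ne_zero
    push_cast
    linear_combination hd - (s - d : ℂ) * h
  refine ⟨⟨q - b + (s - d), ?_⟩, ⟨_, hq⟩, ⟨_, hr⟩, ⟨c - r + (a - p), ?_⟩⟩
  · apply mul_left_cancel₀ theta_ne_zero
    push_cast at hr ⊢
    linear_combination hb + θ * hr - (q - b : ℂ) * h
  · apply mul_left_cancel₀ theta_ne_zero
    push_cast at hq ⊢
    linear_combination -hc + θ * hq - (c - r : ℂ) * h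

/-- The coordinates of a chordal root in `Λ₁₀` are divisible by `θ`. -/
lemma exists_eq_theta_mul {r : Fin 11 → ℂ} (hr : ∀ i, r i ∈ Eis) (hc : innerSet r = threeEis)
    (i : Fin 11) (hi : i ≠ 0) : ∃ t : Eis, r i = θ * t := by
  lift r to Fin 11 → Eis using hr
  have key (j : Fin 11) : ∃ e : Eis, herm11C (fun i => r i) (Pi.single j 1) = 3 * e := by
    have : herm11C (fun i => r i) (Pi.single j 1) ∈ threeEis := by
      rw [← hc]
      refine ⟨_, fun k => ?_, rfl⟩
      rw [Pi.single_apply]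
      split
      exacts [one_mem _, zero_mem _]
    exact this
  choose e he using key
  simp only [herm11C_apply] at he
  have h1 := he 1
  have h2 := he 2
  have h3 := he 3
  have h4 := he 4
  have h5 := he 5
  have h6 := he 6
  have h7 := he 7
  have h8 := he 8
  have h9 := he 9
  have h10 := he 10
  simp at h1 h2 h3 h4 h5 h6 h7 h8 h9 h10
  obtain ⟨d1, d2, d3, d4⟩ := exists_eq_theta_mul_of_Bmat h1 h2 h3 h4
  obtain ⟨d5, d6, d7, d8⟩ := exists_eq_theta_mul_of_Bmat h5 h6 h7 h8
  have d9 : ∃ t : Eis, (r 9 : ℂ) = θ * t := by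
    refine ⟨-e 10, mul_left_cancel₀ theta_ne_zero ?_⟩
    push_cast
    linear_combination h10 + (e 10 : ℂ) * theta_mul_self
  have d10 : ∃ t : Eis, (r 10 : ℂ) = θ * t := by
    refine ⟨e 9, mul_left_cancel₀ theta_ne_zero ?_⟩
    linear_combination -h9 - (e 9 : ℂ) * theta_mul_self
  fin_cases i
  exacts [absurd rfl hi, d1, d2, d3, d4, d5, d6, d7, d8, d9, d10]

/-- The inner product of two chordal roots is, up to the factor `3`, congruent modulo `θ` to the
product of their coordinates along the summand `(3)`. -/
lemma herm11C_chordal {r s : Fin 11 → ℂ} (hr : ∀ i, r i ∈ Eis) (hs : ∀ i, s i ∈ Eis)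
    (hcr : innerSet r = threeEis) (hcs : innerSet s = threeEis) :
    ∃ e : Eis, herm11C r s = 3 * (r 0 * conj (s 0) + θ * e) := by
  choose! t ht using exists_eq_theta_mul hr hcr
  choose! u hu using exists_eq_theta_mul hs hcs
  obtain ⟨v, hv⟩ : ∃ v : Fin 11 → Eis, ∀ i, conj (u i : ℂ) = v i :=
    ⟨fun i => ⟨_, conj_mem_Eis (u i).2⟩, fun _ => rfl⟩
  have hsv (i : Fin 11) (hi : i ≠ 0) : conj (s i) = -θ * v i := by
    rw [hu i hi, map_mul, conj_theta, hv]
  refine ⟨(-θE * t 1 - t 2) * v 1 + (t 1 - θE * t 2 - t 3) * v 2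
    + (t 2 - θE * t 3 - t 4) * v 3 + (t 3 - θE * t 4) * v 4
    + (-θE * t 5 - t 6) * v 5 + (t 5 - θE * t 6 - t 7) * v 6
    + (t 6 - θE * t 7 - t 8) * v 7 + (t 7 - θE * t 8) * v 8
    - t 10 * v 9 + t 9 * v 10, ?_⟩
  rw [herm11C_apply, ht 1 (by decide), ht 2 (by decide), ht 3 (by decide), ht 4 (by decide),
    ht 5 (by decide), ht 6 (by decide), ht 7 (by decide), ht 8 (by decide), ht 9 (by decide),
    ht 10 (by decide), hsv 1 (by decide), hsv 2 (by decide), hsv 3 (by decide), hsv 4 (by decide),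
    hsv 5 (by decide), hsv 6 (by decide), hsv 7 (by decide), hsv 8 (by decide), hsv 9 (by decide),
    hsv 10 (by decide)]
  push_cast [coe_θE]
  have h3 : (3 : ℂ) = -(θ * θ) := by rw [theta_mul_self, neg_neg]
  rw [h3]
  ring

/-- No two chordal hyperplanes meet in complex hyperbolic 10-space: if
`r` and `s` are chordal roots of `Λ`, neither a complex multiple of the other, then no
vector `x ∈ ℂ¹¹` of negative norm is orthogonal to both. -/
theorem stmt_13 :
    ∀ r s : Fin 11 → ℂ,
      (∀ i, r i ∈ Eis) → (∀ i, s i ∈ Eis) →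
      herm11C r r = 3 → herm11C s s = 3 →
      innerSet r = threeEis → innerSet s = threeEis →
      (¬ ∃ c : ℂ, r = c • s) → (¬ ∃ c : ℂ, s = c • r) →
      ¬ ∃ x : Fin 11 → ℂ, (herm11C x x).re < 0 ∧ herm11C x r = 0 ∧ herm11C x s = 0 := by
  rintro r s hr hs hrr hss hcr hcs hrs - ⟨x, hx, hxr, hxs⟩
  obtain ⟨a, ha⟩ := herm11C_chordal hr hs hcr hcs
  obtain ⟨b, hb⟩ := herm11C_chordal hr hr hcr hcr
  obtain ⟨c, hc⟩ := herm11C_chordal hs hs hcs hcs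
  obtain ⟨r₀, hr₀⟩ : ∃ e : Eis, r 0 = e := ⟨⟨_, hr 0⟩, rfl⟩
  obtain ⟨s₀, hs₀⟩ : ∃ e : Eis, s 0 = e := ⟨⟨_, hs 0⟩, rfl⟩
  obtain ⟨r₁, hr₁⟩ : ∃ e : Eis, conj (r 0) = e := ⟨⟨_, conj_mem_Eis (hr 0)⟩, rfl⟩
  obtain ⟨s₁, hs₁⟩ : ∃ e : Eis, conj (s 0) = e := ⟨⟨_, conj_mem_Eis (hs 0)⟩, rfl⟩
  rw [hrr] at hb
  rw [hss] at hc
  have h3 : (3 : ℂ) ≠ 0 := by norm_num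
  have hb' : (1 : ℂ) = r₀ * r₁ + θ * b := by
    rw [← hr₀, ← hr₁]; exact mul_left_cancel₀ h3 (by rw [← hb, mul_one])
  have hc' : (1 : ℂ) = s₀ * s₁ + θ * c := by
    rw [← hs₀, ← hs₁]; exact mul_left_cancel₀ h3 (by rw [← hc, mul_one])
  have hne : r 0 * conj (s 0) + θ * a ≠ 0 := by
    rw [hr₀, hs₁]
    intro h0
    refine theta_mul_ne_one (b * (s₀ * s₁) + (r₀ * r₁ + θE * b) * c - a * (r₁ * s₀)) ?_
    push_cast [coe_θE]
    linear_combination (-r₁ * s₀ : ℂ) * h0 - hb' - (r₀ * r₁ + θ * b) * hc'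
  obtain ⟨z, hz⟩ : ∃ z : Eis, r 0 * conj (s 0) + θ * a = z :=
    ⟨r₀ * s₁ + θE * a, by push_cast [coe_θE]; rw [hr₀, hs₁]⟩
  rw [hz] at ha hne
  have hz1 : 1 ≤ Complex.normSq z := one_le_normSq z hne
  refine hrs ⟨z, ?_⟩
  rw [← sub_eq_zero]
  refine eq_zero_of_orthogonal_of_neg (x := x) hx ?_ ?_
  · rw [herm11C_sub_smul_right, hxr, hxs]; ring
  · rw [herm11C_sub_smul_right, herm11C_sub_smul_left, herm11C_sub_smul_left, herm11C_conj s r,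
      hrr, hss, ha]
    have : (3 : ℂ) - z * conj (3 * (z : ℂ)) - conj (z : ℂ) * (3 * z - z * 3)
        = ((3 - 3 * Complex.normSq z : ℝ) : ℂ) := by
      push_cast
      rw [← Complex.mul_conj, map_mul, Complex.conj_ofNat]
      ring
    rw [this, Complex.ofReal_re]
    linarith
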